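/- arXiv:math/0502136 — 2 statements merged into one kernel-verified Lean document; each statement's English description precedes it below -/
import Mathlib

section
/- Let M be a compact metric space and let c : M×M → ℝ be a continuous cost function satisfying the triangle inequality c(x,z) ≤ c(x,y) + c(y,z) for all x, y, z ∈ M and c(x,x) = 0 for all x ∈ M. Given two Borel probability measures μ0 and μ1 on M, there exists a continuous function u : M → ℝ such that u(y) − u(x) ≤ c(x,y) for all x, y ∈ M and K(μ0,μ1) = ∫_M u d(μ1 − μ0). Moreover, for every optimal transport plan μ, the equality u(y) − u(x) = c(x,y) holds for μ-almost every (x,y) ∈ M×M. -/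
open MeasureTheory Set
open scoped Manifold ENNReal NNReal Topology
noncomputable section

namespace MongePaper

section Transport

variable {X : Type*} [TopologicalSpace X] [MeasurableSpace X]

/-- `F` transports `μ0` onto `μ1` : it is measurable (Borel) and `F_♯ μ0 = μ1`. -/
def Transports (μ0 μ1 : MeasureTheory.Measure X) (F : X → X) : Prop :=
  Measurable F ∧ MeasureTheory.Measure.map F μ0 = μ1

/-- A transport plan between `μ0` and `μ1` : a probability measure on `X × X`
whose marginals are `μ0` and `μ1`. -/
def IsTransportPlan (μ0 μ1 : MeasureTheory.Measure X) (μ : MeasureTheory.Measure (X × X)) : Prop :=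
  MeasureTheory.IsProbabilityMeasure μ ∧
    μ.map Prod.fst = μ0 ∧ μ.map Prod.snd = μ1

/-- The minimal (Kantorovich) transport cost `K(μ0, μ1)` for the cost `c`. -/
def minCost (c : X → X → ℝ) (μ0 μ1 : MeasureTheory.Measure X) : ℝ :=
  sInf {a | ∃ μ : MeasureTheory.Measure (X × X), IsTransportPlan μ0 μ1 μ ∧
    a = ∫ p, c p.1 p.2 ∂μ}

/-- `μ` is an optimal transport plan for the cost `c`. -/
def IsOptimalPlan (c : X → X → ℝ) (μ0 μ1 : MeasureTheory.Measure X)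
    (μ : MeasureTheory.Measure (X × X)) : Prop :=
  IsTransportPlan μ0 μ1 μ ∧ (∫ p, c p.1 p.2 ∂μ) = minCost c μ0 μ1

/-- A Kantorovich potential for the cost `c` and the marginals `μ0`, `μ1`. -/
def IsKantorovichPotential (c : X → X → ℝ) (μ0 μ1 : MeasureTheory.Measure X)
    (u : X → ℝ) : Prop :=
  Continuous u ∧ (∀ x y : X, u y - u x ≤ c x y) ∧
    (∫ x, u x ∂μ1) - (∫ x, u x ∂μ0) = minCost c μ0 μ1

end Transport

end MongePaper

namespace MongePaper

/-- Hahn-Banach at a point for a sublinear functional. -/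
lemma hb_point {E : Type*} [AddCommGroup E] [Module ℝ E] (N : E → ℝ)
    (N_hom : ∀ c : ℝ, 0 < c → ∀ x, N (c • x) = c * N x)
    (N_add : ∀ x y, N (x + y) ≤ N x + N y) (v : E) :
    ∃ g : E →ₗ[ℝ] ℝ, g v = N v ∧ ∀ x, g x ≤ N x := by
  have N_0 : N 0 = 0 := by
    have := N_hom 2 (by norm_num) 0
    rw [smul_zero] at this; linarith
  have H : ∀ t : ℝ, t • v = 0 → (RingHom.id ℝ) t • N v = 0 := by
    intro t ht
    rcases smul_eq_zero.1 ht with h | h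
    · simp [h]
    · simp [h, N_0]
  obtain ⟨g, hg, hgN⟩ := exists_extension_of_le_sublinear
    (LinearPMap.mkSpanSingleton' (σ := RingHom.id ℝ) v (N v) H) N N_hom N_add (by
      rintro ⟨x, hx⟩
      obtain ⟨t, rfl⟩ := Submodule.mem_span_singleton.1 hx
      rw [LinearPMap.mkSpanSingleton'_apply]
      simp only [RingHom.id_apply, smul_eq_mul]
      rcases lt_trichotomy t 0 with h | h | h
      · have h1 := N_hom (-t) (by linarith) v
        have h2 := N_add (t • v) ((-t) • v)
        rw [← add_smul, add_neg_cancel, zero_smul, N_0, h1] at h2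
        linarith
      · simp [h, N_0]
      · rw [N_hom t h])
  refine ⟨g, ?_, hgN⟩
  have h := hg ⟨v, Submodule.mem_span_singleton_self v⟩
  exact h.trans (LinearPMap.mkSpanSingleton'_apply_self (σ := RingHom.id ℝ) v (N v) H _)

section
variable {X : Type*} [MetricSpace X] [CompactSpace X] [MeasurableSpace X] [BorelSpace X]

lemma integrable_of_cont {Y : Type*} [TopologicalSpace Y] [CompactSpace Y] [MeasurableSpace Y]
    [OpensMeasurableSpace Y] (μ : Measure Y) [IsFiniteMeasure μ] {f : Y → ℝ}
    (hf : Continuous f) : Integrable f μ :=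
  hf.integrable_of_hasCompactSupport (HasCompactSupport.of_compactSpace f)

lemma plan_integral {μ0 μ1 : Measure X} {μ : Measure (X × X)} (h : IsTransportPlan μ0 μ1 μ)
    {φ ψ : X → ℝ} (hφ : Continuous φ) (hψ : Continuous ψ) :
    ∫ p, (φ p.1 + ψ p.2) ∂μ = ∫ x, φ x ∂μ0 + ∫ x, ψ x ∂μ1 := by
  obtain ⟨hp, h0, h1⟩ := h
  rw [integral_add (integrable_of_cont μ (by fun_prop)) (integrable_of_cont μ (by fun_prop)),
    ← h0, ← h1, integral_map (by fun_prop) hφ.aestronglyMeasurable,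
    integral_map (by fun_prop) hψ.aestronglyMeasurable]

lemma prod_plan (μ0 μ1 : Measure X) [IsProbabilityMeasure μ0] [IsProbabilityMeasure μ1] :
    IsTransportPlan μ0 μ1 (μ0.prod μ1) :=
  ⟨inferInstance, by simp, by simp⟩

/-- Values of the dual problem dominating `f`. -/
def dualSet (μ0 μ1 : Measure X) (f : C(X × X, ℝ)) : Set ℝ :=
  {r | ∃ φ ψ : X → ℝ, Continuous φ ∧ Continuous ψ ∧ (∀ x y, f (x, y) ≤ φ x + ψ y) ∧
    r = ∫ x, φ x ∂μ0 + ∫ x, ψ x ∂μ1}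

variable (μ0 μ1 : Measure X) [IsProbabilityMeasure μ0] [IsProbabilityMeasure μ1]

lemma dualSet_nonempty (f : C(X × X, ℝ)) : (dualSet μ0 μ1 f).Nonempty :=
  ⟨_, fun _ => ‖f‖, fun _ => 0, continuous_const, continuous_const,
    fun x y => by simpa using (le_abs_self _).trans (f.norm_coe_le_norm (x, y)), rfl⟩

lemma dual_ge {f : C(X × X, ℝ)} {μ : Measure (X × X)} (h : IsTransportPlan μ0 μ1 μ)
    {r : ℝ} (hr : r ∈ dualSet μ0 μ1 f) : ∫ p, f p ∂μ ≤ r := by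
  obtain ⟨φ, ψ, hφ, hψ, hle, rfl⟩ := hr
  have := h.1
  rw [← plan_integral h hφ hψ]
  exact integral_mono (integrable_of_cont μ f.continuous)
    (integrable_of_cont μ (by fun_prop)) (fun p => hle p.1 p.2)

lemma dualSet_bdd (f : C(X × X, ℝ)) : BddBelow (dualSet μ0 μ1 f) :=
  ⟨_, fun _ hr => dual_ge μ0 μ1 (prod_plan μ0 μ1) hr⟩

/-- There is a plan whose cost is the value of the dual problem. -/
lemma exists_plan (f : C(X × X, ℝ)) :
    ∃ μ, IsTransportPlan μ0 μ1 μ ∧ ∫ p, f p ∂μ = sInf (dualSet μ0 μ1 f) := by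
  obtain ⟨g, hgf, hg⟩ := hb_point (fun f => sInf (dualSet μ0 μ1 f)) (by
    have key : ∀ t : ℝ, 0 < t → ∀ f : C(X × X, ℝ),
        t * sInf (dualSet μ0 μ1 f) ≤ sInf (dualSet μ0 μ1 (t • f)) := by
      intro t ht f
      refine le_csInf (dualSet_nonempty μ0 μ1 _) ?_
      rintro r ⟨φ, ψ, hφ, hψ, hle, rfl⟩
      rw [← le_inv_mul_iff₀ ht]
      refine csInf_le (dualSet_bdd μ0 μ1 f) ⟨fun x => t⁻¹ * φ x, fun x => t⁻¹ * ψ x,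
        by fun_prop, by fun_prop, fun x y => ?_, ?_⟩
      · have := hle x y
        simp only [ContinuousMap.smul_apply, smul_eq_mul] at this
        rw [← mul_add, le_inv_mul_iff₀ ht]
        exact this
      · rw [integral_const_mul, integral_const_mul, mul_add]
    intro t ht f
    refine le_antisymm ?_ (key t ht f)
    have h := key t⁻¹ (inv_pos.2 ht) (t • f)
    rw [smul_smul, inv_mul_cancel₀ ht.ne', one_smul, inv_mul_le_iff₀ ht] at h
    exact h) (by
    intro f1 f2
    rw [← sub_le_iff_le_add]
    refine le_csInf (dualSet_nonempty μ0 μ1 _) ?_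
    rintro r ⟨φ, ψ, hφ, hψ, hle, rfl⟩
    rw [sub_le_comm]
    refine le_csInf (dualSet_nonempty μ0 μ1 _) ?_
    rintro r ⟨φ', ψ', hφ', hψ', hle', rfl⟩
    rw [sub_le_iff_le_add]
    refine csInf_le (dualSet_bdd μ0 μ1 _) ⟨fun x => φ x + φ' x, fun x => ψ x + ψ' x,
        by fun_prop, by fun_prop, fun x y => ?_, ?_⟩
    · have h1 := hle x y
      have h2 := hle' x y
      simp only [ContinuousMap.add_apply]
      linarith
    · rw [integral_add (integrable_of_cont _ hφ) (integrable_of_cont _ hφ'),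
        integral_add (integrable_of_cont _ hψ) (integrable_of_cont _ hψ')]
      ring) f
  have hle : ∀ (f : C(X × X, ℝ)) (φ ψ : X → ℝ), Continuous φ → Continuous ψ →
      (∀ x y, f (x, y) ≤ φ x + ψ y) → g f ≤ ∫ x, φ x ∂μ0 + ∫ x, ψ x ∂μ1 :=
    fun f φ ψ hφ hψ h => (hg f).trans
      (csInf_le (dualSet_bdd μ0 μ1 f) ⟨φ, ψ, hφ, hψ, h, rfl⟩)
  have heq : ∀ (f : C(X × X, ℝ)) (φ ψ : X → ℝ), Continuous φ → Continuous ψ →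
      (∀ x y, f (x, y) = φ x + ψ y) → g f = ∫ x, φ x ∂μ0 + ∫ x, ψ x ∂μ1 := by
    intro f φ ψ hφ hψ h
    refine le_antisymm (hle f φ ψ hφ hψ fun x y => (h x y).le) ?_
    have := hle (-f) (fun x => -φ x) (fun x => -ψ x) hφ.neg hψ.neg
      (fun x y => by simp [h x y, add_comm])
    rw [map_neg, integral_neg, integral_neg] at this
    linarith
  let L : CompactlySupportedContinuousMap (X × X) ℝ →ₗ[ℝ] ℝ :=
    { toFun := fun f => g f.toContinuousMap
      map_add' := fun a b => by rw [← map_add]; rfl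
      map_smul' := fun a b => by rw [RingHom.id_apply, ← map_smul]; rfl }
  let Λ : CompactlySupportedContinuousMap (X × X) ℝ →ₚ[ℝ] ℝ := PositiveLinearMap.mk₀ L (by
    intro f hf
    have := hle (-f.toContinuousMap) (fun _ => 0) (fun _ => 0) continuous_const continuous_const
      (fun x y => by simpa using hf (x, y))
    rw [map_neg] at this
    simp only [integral_zero, add_zero] at this
    change 0 ≤ g f.toContinuousMap
    linarith)
  have hint : ∀ f : C(X × X, ℝ), ∫ p, f p ∂(RealRMK.rieszMeasure Λ) = g f := fun f =>
    RealRMK.integral_rieszMeasure Λ (CompactlySupportedContinuousMap.continuousMapEquiv f)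
  have h0 : (RealRMK.rieszMeasure Λ).map Prod.fst = μ0 := by
    refine ext_of_forall_integral_eq_of_IsFiniteMeasure fun φ => ?_
    rw [integral_map (by fun_prop) φ.continuous.aestronglyMeasurable]
    refine (hint ⟨fun p => φ p.1, by fun_prop⟩).trans ?_
    rw [heq _ φ (fun _ => 0) φ.continuous continuous_const (by simp)]
    simp
  have h1 : (RealRMK.rieszMeasure Λ).map Prod.snd = μ1 := by
    refine ext_of_forall_integral_eq_of_IsFiniteMeasure fun φ => ?_
    rw [integral_map (by fun_prop) φ.continuous.aestronglyMeasurable]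
    refine (hint ⟨fun p => φ p.2, by fun_prop⟩).trans ?_
    rw [heq _ (fun _ => 0) φ continuous_const φ.continuous (by simp)]
    simp
  refine ⟨RealRMK.rieszMeasure Λ, ⟨⟨?_⟩, h0, h1⟩, (hint f).trans hgf⟩
  have : (RealRMK.rieszMeasure Λ).map Prod.fst univ = 1 := by rw [h0]; simp
  rwa [Measure.map_apply measurable_fst MeasurableSet.univ, preimage_univ] at this

lemma small_nhds {c : X → X → ℝ} (hc : Continuous fun p : X × X => c p.1 p.2)
    (hdiag : ∀ x : X, c x x = 0) (x : X) {ε : ℝ} (hε : 0 < ε) :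
    ∀ᶠ y in 𝓝 x, ∀ u : X → ℝ, (∀ x y : X, u y - u x ≤ c x y) → dist (u x) (u y) < ε := by
  have c1 : Continuous fun y => c x y := hc.comp (by fun_prop : Continuous fun y => (x, y))
  have c2 : Continuous fun y => c y x := hc.comp (by fun_prop : Continuous fun y => (y, x))
  have e1 := c1.continuousAt.eventually_lt (continuousAt_const (x := x) (y := ε))
    (by simpa [hdiag] using hε)
  have e2 := c2.continuousAt.eventually_lt (continuousAt_const (x := x) (y := ε))
    (by simpa [hdiag] using hε)
  filter_upwards [e1, e2] with y h1 h2 u hu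
  rw [Real.dist_eq, abs_lt]
  constructor <;> linarith [hu x y, hu y x]

lemma cont_of_le {c : X → X → ℝ} (hc : Continuous fun p : X × X => c p.1 p.2)
    (hdiag : ∀ x : X, c x x = 0) {u : X → ℝ} (hu : ∀ x y : X, u y - u x ≤ c x y) :
    Continuous u := by
  rw [continuous_iff_continuousAt]
  intro x
  rw [ContinuousAt, Metric.tendsto_nhds]
  intro ε hε
  filter_upwards [small_nhds hc hdiag x hε] with y hy
  rw [dist_comm]
  exact hy u hu

lemma exists_max {c : X → X → ℝ} (hc : Continuous fun p : X × X => c p.1 p.2)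
    (hcnn : ∃ φ : X → ℝ, ∀ x y : X, φ y - φ x ≤ c x y)
    (hdiag : ∀ x : X, c x x = 0) :
    ∃ u : X → ℝ, Continuous u ∧ (∀ x y : X, u y - u x ≤ c x y) ∧
      ∀ v : X → ℝ, (∀ x y : X, v y - v x ≤ c x y) →
        ∫ x, v x ∂μ1 - ∫ x, v x ∂μ0 ≤ ∫ x, u x ∂μ1 - ∫ x, u x ∂μ0 := by
  obtain ⟨x0⟩ : Nonempty X := μ0.nonempty_of_neZero
  let A : Set (BoundedContinuousFunction X ℝ) :=
    {u | u x0 = 0 ∧ ∀ x y, u y - u x ≤ c x y}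
  let C : C(X × X, ℝ) := ⟨_, hc⟩
  have hC : ∀ x y, c x y ≤ ‖C‖ := fun x y => (le_abs_self _).trans (C.norm_coe_le_norm (x, y))
  have hcl : IsClosed A := by
    have : A = {u | u x0 = 0} ∩ ⋂ x, ⋂ y, {u | u y - u x ≤ c x y} := by
      ext u; simp [A]
    rw [this]
    refine (isClosed_eq (continuous_eval_const _) continuous_const).inter
      (isClosed_iInter fun x => isClosed_iInter fun y => isClosed_le
        ((continuous_eval_const _).sub
          (continuous_eval_const _)) continuous_const)
  have hcomp : IsCompact A := by
    refine BoundedContinuousFunction.arzela_ascoli₂ (Icc (-‖C‖) ‖C‖) isCompact_Icc A hcl ?_ ?_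
    · rintro u x ⟨h0, hu⟩
      constructor
      · linarith [hu x x0, hC x x0]
      · linarith [hu x0 x, hC x0 x]
    · intro x
      rw [Metric.equicontinuousAt_iff_right]
      intro ε hε
      filter_upwards [small_nhds hc hdiag x hε] with y hy u
      exact hy _ u.2.2
  have norm_mem : ∀ v : X → ℝ, (∀ x y : X, v y - v x ≤ c x y) →
      ∃ w ∈ A, ∀ x, w x = v x - v x0 := by
    intro v hv
    have hvc := cont_of_le hc hdiag hv
    refine ⟨BoundedContinuousFunction.mkOfCompact ⟨fun x => v x - v x0, by fun_prop⟩, ⟨?_, ?_⟩, ?_⟩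
    · simp
    · intro x y; simpa using hv x y
    · intro x; simp
  have hne : A.Nonempty := by
    obtain ⟨φ, hφ⟩ := hcnn
    obtain ⟨w, hw, -⟩ := norm_mem φ hφ
    exact ⟨w, hw⟩
  have hcont : Continuous fun u : BoundedContinuousFunction X ℝ =>
      ∫ x, u x ∂μ1 - ∫ x, u x ∂μ0 := by
    have : ∀ μ : Measure X, IsProbabilityMeasure μ →
        Continuous fun u : BoundedContinuousFunction X ℝ => ∫ x, u x ∂μ := by
      intro μ _
      refine LipschitzWith.continuous (K := 1) (LipschitzWith.of_dist_le_mul fun u v => ?_)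
      rw [dist_eq_norm, ← integral_sub (integrable_of_cont _ u.continuous)
        (integrable_of_cont _ v.continuous)]
      refine (norm_integral_le_of_norm_le_const (C := dist u v)
        (Filter.Eventually.of_forall fun x => ?_)).trans (by simp)
      rw [← dist_eq_norm]
      exact BoundedContinuousFunction.dist_coe_le_dist x
    exact (this μ1 inferInstance).sub (this μ0 inferInstance)
  obtain ⟨u, hu, hmax⟩ := hcomp.exists_isMaxOn hne hcont.continuousOn
  refine ⟨u, u.continuous, hu.2, fun v hv => ?_⟩
  obtain ⟨w, hw, hwv⟩ := norm_mem v hv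
  have h := hmax hw
  simp only [mem_ofPred_eq, hwv] at h
  have hvc := cont_of_le hc hdiag hv
  rw [integral_sub (integrable_of_cont _ hvc) (integrable_const _),
    integral_sub (integrable_of_cont _ hvc) (integrable_const _)] at h
  simp at h
  linarith

/-- Improving a dual pair to a single potential. -/
lemma exists_improve {c : X → X → ℝ} (hc : Continuous fun p : X × X => c p.1 p.2)
    (htri : ∀ x y z : X, c x z ≤ c x y + c y z) (hdiag : ∀ x : X, c x x = 0)
    {φ ψ : X → ℝ} (hφ : Continuous φ) (hψ : Continuous ψ)
    (h : ∀ x y, -c x y ≤ φ x + ψ y) :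
    ∃ v : X → ℝ, (∀ x y : X, v y - v x ≤ c x y) ∧
      -(∫ x, φ x ∂μ0 + ∫ x, ψ x ∂μ1) ≤ ∫ x, v x ∂μ1 - ∫ x, v x ∂μ0 := by
  have : Nonempty X := μ0.nonempty_of_neZero
  have hbdd : ∀ y, BddBelow (range fun x => c x y + φ x) := fun y =>
    ⟨-ψ y, by rintro _ ⟨x, rfl⟩; linarith [h x y]⟩
  have hv : ∀ x y : X, (⨅ z, (c z y + φ z)) - (⨅ z, (c z x + φ z)) ≤ c x y := by
    intro x y
    rw [sub_le_comm]
    refine le_ciInf fun z => ?_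
    have := ciInf_le (hbdd y) z
    linarith [htri z x y]
  have hvc := cont_of_le hc hdiag (u := fun y => ⨅ z, (c z y + φ z)) hv
  refine ⟨fun y => ⨅ z, (c z y + φ z), hv, ?_⟩
  have h1 : ∫ x, -ψ x ∂μ1 ≤ ∫ y, (⨅ z, (c z y + φ z)) ∂μ1 :=
    integral_mono (integrable_of_cont _ hψ.neg) (integrable_of_cont _ hvc)
      fun y => le_ciInf fun z => by linarith [h z y]
  have h0 : ∫ y, (⨅ z, (c z y + φ z)) ∂μ0 ≤ ∫ x, φ x ∂μ0 :=
    integral_mono (integrable_of_cont _ hvc) (integrable_of_cont _ hφ)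
      fun y => (ciInf_le (hbdd y) y).trans (by simp [hdiag])
  rw [integral_neg] at h1
  linarith

end

/-- (Kantorovich duality for triangle-inequality costs) On a compact metric
space, for a continuous cost satisfying the triangle inequality and vanishing on the
diagonal, there is a Kantorovich potential `u`, i.e. a continuous function with
`u(y) - u(x) ≤ c(x,y)` and `K(μ0,μ1) = ∫ u d(μ1 - μ0)`; moreover every optimal transport
plan is concentrated where `u(y) - u(x) = c(x,y)`. -/
theorem kantorovich_potential_exists {X : Type*} [MetricSpace X] [CompactSpace X]
    [MeasurableSpace X] [BorelSpace X]
    (c : X → X → ℝ) (hc : Continuous fun p : X × X => c p.1 p.2)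
    (htri : ∀ x y z : X, c x z ≤ c x y + c y z) (hdiag : ∀ x : X, c x x = 0)
    (μ0 μ1 : MeasureTheory.Measure X)
    [MeasureTheory.IsProbabilityMeasure μ0] [MeasureTheory.IsProbabilityMeasure μ1] :
    ∃ u : X → ℝ, IsKantorovichPotential c μ0 μ1 u ∧
      ∀ μ : MeasureTheory.Measure (X × X), IsOptimalPlan c μ0 μ1 μ →
        ∀ᵐ p ∂μ, u p.2 - u p.1 = c p.1 p.2 := by
  let F : C(X × X, ℝ) := ⟨fun p => -c p.1 p.2, hc.neg⟩
  have hx : Nonempty X := μ0.nonempty_of_neZero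
  obtain ⟨x0⟩ := hx
  obtain ⟨u, huc, hu, hmax⟩ := exists_max μ0 μ1 hc
    ⟨fun y => c x0 y, fun x y => by linarith [htri x0 x y]⟩ hdiag
  -- every plan costs at least the dual value
  have hlow : ∀ μ, IsTransportPlan μ0 μ1 μ →
      ∫ x, u x ∂μ1 - ∫ x, u x ∂μ0 ≤ ∫ p, c p.1 p.2 ∂μ := by
    intro μ hμ
    have := dual_ge μ0 μ1 (f := F) hμ
      ⟨u, fun x => -u x, huc, huc.neg, fun x y => by
        change -c x y ≤ _
        linarith [hu x y], rfl⟩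
    change ∫ p, -c p.1 p.2 ∂μ ≤ _ at this
    rw [integral_neg, integral_neg] at this
    linarith
  obtain ⟨π, hπ, hπF⟩ := exists_plan μ0 μ1 F
  have hup : ∫ p, c p.1 p.2 ∂π ≤ ∫ x, u x ∂μ1 - ∫ x, u x ∂μ0 := by
    have h1 : -(∫ x, u x ∂μ1 - ∫ x, u x ∂μ0) ≤ sInf (dualSet μ0 μ1 F) := by
      refine le_csInf (dualSet_nonempty μ0 μ1 F) ?_
      rintro r ⟨φ, ψ, hφ, hψ, hle, rfl⟩
      obtain ⟨v, hv, hvle⟩ := exists_improve μ0 μ1 hc htri hdiag hφ hψ hle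
      linarith [hmax v hv]
    rw [← hπF] at h1
    change _ ≤ ∫ p, -c p.1 p.2 ∂π at h1
    rw [integral_neg] at h1
    linarith
  have hmin : ∫ x, u x ∂μ1 - ∫ x, u x ∂μ0 = minCost c μ0 μ1 := by
    refine le_antisymm ?_ ?_
    · refine le_csInf ⟨_, π, hπ, rfl⟩ ?_
      rintro a ⟨μ, hμ, rfl⟩
      exact hlow μ hμ
    · refine le_trans ?_ hup
      refine csInf_le ⟨∫ x, u x ∂μ1 - ∫ x, u x ∂μ0, ?_⟩ ⟨π, hπ, rfl⟩
      rintro a ⟨μ, hμ, rfl⟩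
      exact hlow μ hμ
  refine ⟨u, ⟨huc, hu, hmin⟩, ?_⟩
  rintro μ ⟨hμ, hopt⟩
  have hp := hμ.1
  have hs := plan_integral hμ (φ := fun x => -u x) huc.neg huc
  have hi1 : Integrable (fun p : X × X => c p.1 p.2) μ := integrable_of_cont μ hc
  have hi2 : Integrable (fun p : X × X => -u p.1 + u p.2) μ :=
    integrable_of_cont μ (by fun_prop)
  have hz : ∫ p, (c p.1 p.2 - (-u p.1 + u p.2)) ∂μ = 0 := by
    rw [integral_sub hi1 hi2, hs, hopt, ← hmin, integral_neg]
    ring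
  have hae := (integral_eq_zero_iff_of_nonneg (fun p => by
    change 0 ≤ c p.1 p.2 - (-u p.1 + u p.2)
    linarith [hu p.1 p.2]) (hi1.sub hi2)).1 hz
  filter_upwards [hae] with p hp'
  simp only [Pi.zero_apply, Pi.sub_apply] at hp'
  linarith

end MongePaper
end
end

section
/- Let M be a compact metric space, c : M×M → ℝ a continuous cost, and μ0, μ1 Borel probability measures on M. Suppose u : M → ℝ is continuous, satisfies u(y) − u(x) ≤ c(x,y) for all x, y ∈ M, and K(μ0,μ1) = ∫_M u d(μ1 − μ0). Then a transport plan μ is optimal for the cost c if and only if μ is concentrated on the closed set {(x,y) ∈ M×M : c(x,y) = u(y) − u(x)}. -/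
open MeasureTheory Set
open scoped Manifold ENNReal NNReal Topology
noncomputable section

namespace MongePaper

/-- Given a Kantorovich potential `u`, a transport plan is optimal for the
cost `c` if and only if it is concentrated on the closed set
`{(x,y) : c(x,y) = u(y) - u(x)}`. -/
theorem optimal_iff_concentrated {X : Type*} [MetricSpace X] [CompactSpace X]
    [MeasurableSpace X] [BorelSpace X]
    (c : X → X → ℝ) (hc : Continuous fun p : X × X => c p.1 p.2)
    (μ0 μ1 : MeasureTheory.Measure X)
    [MeasureTheory.IsProbabilityMeasure μ0] [MeasureTheory.IsProbabilityMeasure μ1]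
    (u : X → ℝ) (hu : Continuous u) (hsub : ∀ x y : X, u y - u x ≤ c x y)
    (hdual : (∫ x, u x ∂μ1) - (∫ x, u x ∂μ0) = minCost c μ0 μ1) :
    ∀ μ : MeasureTheory.Measure (X × X), IsTransportPlan μ0 μ1 μ →
      (IsOptimalPlan c μ0 μ1 μ ↔
        μ {p : X × X | c p.1 p.2 = u p.2 - u p.1} = 1) := by
  intro μ hμ
  have hplan := hμ
  obtain ⟨hP, h0, h1⟩ := hμ
  have hi : ∀ f : X × X → ℝ, Continuous f → Integrable f μ := fun f hf =>
    hf.integrable_of_hasCompactSupport (HasCompactSupport.of_compactSpace f)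
  have e0 : ∫ x, u x ∂μ0 = ∫ p, u p.1 ∂μ := by
    rw [← h0, integral_map measurable_fst.aemeasurable hu.aestronglyMeasurable]
  have e1 : ∫ x, u x ∂μ1 = ∫ p, u p.2 ∂μ := by
    rw [← h1, integral_map measurable_snd.aemeasurable hu.aestronglyMeasurable]
  have hu1 : Continuous fun p : X × X => u p.1 := hu.comp continuous_fst
  have hu2 : Continuous fun p : X × X => u p.2 := hu.comp continuous_snd
  have hd : Continuous fun p : X × X => u p.2 - u p.1 := hu2.sub hu1
  have key : ∫ p, (c p.1 p.2 - (u p.2 - u p.1)) ∂μ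
      = ∫ p, c p.1 p.2 ∂μ - minCost c μ0 μ1 := by
    rw [integral_sub (hi _ hc) (hi _ hd), integral_sub (hi _ hu2) (hi _ hu1), ← hdual, e0, e1]
  have hz := integral_eq_zero_iff_of_nonneg (μ := μ)
    (f := fun p : X × X => c p.1 p.2 - (u p.2 - u p.1))
    (fun p => sub_nonneg.2 (hsub p.1 p.2)) (hi _ (hc.sub hd))
  have hS : MeasurableSet {p : X × X | c p.1 p.2 = u p.2 - u p.1} :=
    (isClosed_eq hc hd).measurableSet
  have hae : (∀ᵐ p ∂μ, p ∈ {p : X × X | c p.1 p.2 = u p.2 - u p.1}) ↔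
      μ {p : X × X | c p.1 p.2 = u p.2 - u p.1} = 1 := mem_ae_iff_prob_eq_one hS
  rw [← hae]
  have hae2 : (∀ᵐ p ∂μ, p ∈ {p : X × X | c p.1 p.2 = u p.2 - u p.1}) ↔
      (fun p : X × X => c p.1 p.2 - (u p.2 - u p.1)) =ᵐ[μ] 0 := by
    refine Filter.eventually_congr (Filter.Eventually.of_forall fun p => ?_)
    simp only [mem_setOf_eq, Pi.zero_apply, sub_eq_zero]
  rw [hae2, ← hz, key, sub_eq_zero]
  exact ⟨fun h => h.2, fun h => ⟨hplan, h⟩⟩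

end MongePaper
end
end
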